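/- Suppose I ⊆ K{y_1,…,y_n} is a binomial σ-ideal, i.e., a σ-ideal generated by binomials aY^f + bY^g with a, b ∈ K^×. Then ⟨I⟩_r is finitely generated as a radical well-mixed σ-ideal, and consequently every strictly ascending chain of radical well-mixed σ-ideals of K{y_1,…,y_n} generated by binomials is finite. -/

import Mathlib

open Polynomial

section SigmaRing

variable {R : Type*} [CommRing R]

/-- A σ-ideal: an ideal closed under the difference operator σ. -/
def IsSigmaIdeal (σ : R →+* R) (I : Ideal R) : Prop := ∀ a ∈ I, σ a ∈ I

/-- A σ-ideal is well-mixed if `a * b ∈ I` implies `a * σ b ∈ I`. -/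
def IsWellMixed (σ : R →+* R) (I : Ideal R) : Prop := ∀ a b : R, a * b ∈ I → a * σ b ∈ I

/-- `[F]`, the smallest σ-ideal containing `F`. -/
def sigmaIdealGen (σ : R →+* R) (F : Set R) : Ideal R :=
  sInf {I : Ideal R | F ⊆ I ∧ IsSigmaIdeal σ I}

/-- `⟨F⟩`, the smallest well-mixed σ-ideal containing `F` (well-mixed closure). -/
def wmClosure (σ : R →+* R) (F : Set R) : Ideal R :=
  sInf {I : Ideal R | F ⊆ I ∧ IsSigmaIdeal σ I ∧ IsWellMixed σ I}

/-- `⟨F⟩_r`, the smallest radical well-mixed σ-ideal containing `F`. -/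
def rwmClosure (σ : R →+* R) (F : Set R) : Ideal R :=
  sInf {I : Ideal R | F ⊆ I ∧ IsSigmaIdeal σ I ∧ IsWellMixed σ I ∧ I.IsRadical}

/-- Symbolic exponent: for `p = Σ c_i x^i ∈ ℕ[x]`, `a^p = Π (σ^i a)^(c_i)`. -/
noncomputable def sexp (σ : R →+* R) (a : R) (p : Polynomial ℕ) : R :=
  ∏ i ∈ Finset.range (p.natDegree + 1), ((⇑σ)^[i] a) ^ (p.coeff i)

/-- `I` is finitely generated as a radical well-mixed σ-ideal. -/
def FinGenAsRWM (σ : R →+* R) (I : Ideal R) : Prop :=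
  ∃ G : Set R, G.Finite ∧ G ⊆ (I : Set R) ∧ I = rwmClosure σ G

/-- σ-prime: a reflexive σ-ideal which is prime. -/
def IsSigmaPrime (σ : R →+* R) (I : Ideal R) : Prop :=
  IsSigmaIdeal σ I ∧ (∀ a : R, σ a ∈ I → a ∈ I) ∧ I.IsPrime

end SigmaRing

/-- The σ-polynomial ring `K{y_1,…,y_n}`: polynomials in variables `y_i^{x^j}`,
indexed by pairs `(i, j) ∈ Fin n × ℕ`. -/
abbrev DPoly (K : Type*) [Field K] (n : ℕ) := MvPolynomial (Fin n × ℕ) K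

section DPoly

variable {K : Type*} [Field K] {n : ℕ} (σK : K →+* K)

/-- The difference operator on `K{y_1,…,y_n}` extending `σK`, with `σ(y_i^{x^j}) = y_i^{x^{j+1}}`. -/
noncomputable def shift : DPoly K n →+* DPoly K n :=
  MvPolynomial.eval₂Hom ((MvPolynomial.C : K →+* DPoly K n).comp σK)
    (fun v => MvPolynomial.X (v.1, v.2 + 1))

/-- `y_i^p` for `p ∈ ℕ[x]`. -/
noncomputable def ypow (i : Fin n) (p : Polynomial ℕ) : DPoly K n :=
  sexp (shift σK) (MvPolynomial.X (i, 0)) p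

/-- `y_i^{x^a}`. -/
noncomputable def varPow (i : Fin n) (a : ℕ) : DPoly K n :=
  ypow σK i (Polynomial.X ^ a)

/-- The monomial `Y^f = Π y_i^{f_i}` for `f ∈ ℕ[x]^n`. -/
noncomputable def monom (f : Fin n → Polynomial ℕ) : DPoly K n :=
  ∏ i, ypow σK i (f i)

/-- A pure binomial `Y^f − Y^g`. -/
def IsPureBinomial (p : DPoly K n) : Prop :=
  ∃ f g : Fin n → Polynomial ℕ, p = monom σK f - monom σK g

/-- A binomial `a·Y^f + b·Y^g` with `a, b ∈ K^×`. -/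
def IsBinomial (p : DPoly K n) : Prop :=
  ∃ (a b : K) (f g : Fin n → Polynomial ℕ), a ≠ 0 ∧ b ≠ 0 ∧
    p = MvPolynomial.C a * monom σK f + MvPolynomial.C b * monom σK g

/-- A pure binomial σ-ideal: a σ-ideal generated by pure binomials. -/
def IsPureBinomialSigmaIdeal (I : Ideal (DPoly K n)) : Prop :=
  ∃ S : Set (DPoly K n), (∀ p ∈ S, IsPureBinomial σK p) ∧ I = sigmaIdealGen (shift σK) S

/-- Positive part of `f ∈ ℤ[x]`. -/
noncomputable def posPart (f : Polynomial ℤ) : Polynomial ℕ :=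
  f.sum fun i c => Polynomial.monomial i c.toNat

/-- Negative part of `f ∈ ℤ[x]`. -/
noncomputable def negPart (f : Polynomial ℤ) : Polynomial ℕ :=
  f.sum fun i c => Polynomial.monomial i (-c).toNat

/-- The lattice σ-ideal `I_L = [Y^{f_+} − Y^{f_−} : f ∈ L]` of a ℤ[x]-lattice `L ⊆ ℤ[x]^n`. -/
noncomputable def latticeIdeal (L : Submodule (Polynomial ℤ) (Fin n → Polynomial ℤ)) :
    Ideal (DPoly K n) :=
  sigmaIdealGen (shift σK)
    {p | ∃ f ∈ L, p = monom σK (fun i => posPart (f i)) - monom σK (fun i => negPart (f i))}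

end DPoly

/-- `𝔪`: the multiplicatively closed set generated by the variables `y_i^{x^j}`. -/
def mSet (K : Type*) [Field K] (n : ℕ) : Set (DPoly K n) :=
  (Submonoid.closure (Set.range fun v : Fin n × ℕ => (MvPolynomial.X v : DPoly K n)) : Set _)

/-- `I : 𝔪 = {p : M p ∈ I for some M ∈ 𝔪}`. -/
def colonM {K : Type*} [Field K] {n : ℕ} (I : Ideal (DPoly K n)) : Set (DPoly K n) :=
  {p | ∃ M ∈ mSet K n, M * p ∈ I}

section Tsec

variable {K : Type*} [Field K] {n t : ℕ} (σK : K →+* K)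

/-- The set `T^{a_1…a_t}_{j_1…j_t}` of monomials `Y^f` with `deg f_{j_i} < a_i`. -/
def Tset (j : Fin t → Fin n) (a : Fin t → ℕ) : Set (DPoly K n) :=
  {p | ∃ f : Fin n → Polynomial ℕ,
    (∀ i : Fin t, (f (j i)).degree < (a i : WithBot ℕ)) ∧ p = monom σK f}

/-- `I` is saturated with respect to `{y_{j_1}^{x^{a_1}},…,y_{j_t}^{x^{a_t}}}`. -/
def SaturatedWrt (j : Fin t → Fin n) (a : Fin t → ℕ) (I : Ideal (DPoly K n)) : Prop :=
  ∀ g M : DPoly K n, M ∈ Tset σK j a → M * g ∈ I → g ∈ I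

/-- `J : T = {g : M g ∈ J for some M ∈ T}`. -/
def colonT (j : Fin t → Fin n) (a : Fin t → ℕ) (J : Ideal (DPoly K n)) : Set (DPoly K n) :=
  {g | ∃ M ∈ Tset σK j a, M * g ∈ J}

/-- The `T`-saturated closure `N^{a_1…a_t}_{j_1…j_t}(I)`: the smallest saturated σ-ideal
containing `I`. -/
noncomputable def Nclosure (j : Fin t → Fin n) (a : Fin t → ℕ) (I : Ideal (DPoly K n)) :
    Ideal (DPoly K n) :=
  sInf {J : Ideal (DPoly K n) | I ≤ J ∧ IsSigmaIdeal (shift σK) J ∧ SaturatedWrt σK j a J}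

/-- The set of variables `{y_{j_1}^{x^{a_1}},…,y_{j_t}^{x^{a_t}}}`. -/
noncomputable def varSet (j : Fin t → Fin n) (a : Fin t → ℕ) : Set (DPoly K n) :=
  Set.range fun i => varPow σK (j i) (a i)

/-- `⟨I₀ ∪ {y_{j_1}^{x^{a_1}},…,y_{j_t}^{x^{a_t}}}⟩_r` is quasi-normal. -/
def QuasiNormal (j : Fin t → Fin n) (a : Fin t → ℕ) (I0 : Ideal (DPoly K n)) : Prop :=
  SaturatedWrt σK j a I0 ∧
  ∀ f g : Fin n → Polynomial ℕ, monom σK f - monom σK g ∈ I0 →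
    monom σK f ∈ sigmaIdealGen (shift σK) (varSet σK j a) →
    monom σK g ∈ sigmaIdealGen (shift σK) (varSet σK j a)

end Tsec

section TruncatedLattices

open Filter

variable {ι : Type*}

/-- Multiplication by `x` on `ℤ[x]^ι`, whose elements are written as finitely supported
functions on `ι × ℕ`. -/
noncomputable def expShift : ((ι × ℕ) →₀ ℤ) →ₗ[ℤ] ((ι × ℕ) →₀ ℤ) :=
  Finsupp.lmapDomain ℤ ℤ fun v => (v.1, v.2 + 1)

theorem expShift_injective_index : Function.Injective fun v : ι × ℕ => (v.1, v.2 + 1) := by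
  rintro ⟨i, d⟩ ⟨j, e⟩ h
  simpa using h

@[simp]
theorem expShift_succ (h : (ι × ℕ) →₀ ℤ) (i : ι) (d : ℕ) :
    expShift h (i, d + 1) = h (i, d) :=
  Finsupp.mapDomain_apply expShift_injective_index h (i, d)

@[simp]
theorem expShift_zero (h : (ι × ℕ) →₀ ℤ) (i : ι) : expShift h (i, 0) = 0 :=
  Finsupp.mapDomain_of_notMem_range _ _ (by rintro ⟨v, hv⟩; simp at hv)

/-- Elements supported on the components in `T` whose components in `G` have weighted degree
`deg + c` less than `D`. -/
def degLT (T G : Finset ι) (c : ι → ℕ) (D : ℕ) : Submodule ℤ ((ι × ℕ) →₀ ℤ) where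
  carrier := {h | ∀ v, h v ≠ 0 → v.1 ∈ T ∧ (v.1 ∈ G → v.2 + c v.1 < D)}
  zero_mem' := by simp
  add_mem' {g h} hg hh v hv := by
    by_cases hgv : g v = 0
    · exact hh v fun hhv => hv (by simp [hgv, hhv])
    · exact hg v hgv
  smul_mem' z h hh v hv := hh v fun hhv => hv (by simp [hhv])

open Classical in
/-- The vector of coefficients of weighted degree exactly `D` of the components in `G`. -/
noncomputable def topCoeff (G : Finset ι) (c : ι → ℕ) (D : ℕ) :
    ((ι × ℕ) →₀ ℤ) →ₗ[ℤ] (ι → ℤ) :=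
  LinearMap.pi fun i => if i ∈ G ∧ c i ≤ D then Finsupp.lapply (i, D - c i) else 0

open Classical in
theorem topCoeff_apply (G : Finset ι) (c : ι → ℕ) (D : ℕ) (h : (ι × ℕ) →₀ ℤ) (i : ι) :
    topCoeff G c D h i = if i ∈ G ∧ c i ≤ D then h (i, D - c i) else 0 := by
  simp only [topCoeff, LinearMap.pi_apply]
  split_ifs <;> simp

theorem topCoeff_of_add_eq {G : Finset ι} {c : ι → ℕ} {D d : ℕ} {i : ι} (hi : i ∈ G)
    (hd : d + c i = D) (h : (ι × ℕ) →₀ ℤ) : topCoeff G c D h i = h (i, d) := by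
  rw [topCoeff_apply, if_pos ⟨hi, by omega⟩, show D - c i = d by omega]

theorem topCoeff_eq_zero_of_forall {G : Finset ι} {c : ι → ℕ} {D : ℕ} {h : (ι × ℕ) →₀ ℤ}
    (H : ∀ i ∈ G, ∀ d, d + c i = D → h (i, d) = 0) : topCoeff G c D h = 0 := by
  funext i
  rw [topCoeff_apply]
  split_ifs with hi
  · exact H i hi.1 _ (by omega)
  · rfl

theorem topCoeff_expShift (G : Finset ι) (c : ι → ℕ) (D : ℕ) (h : (ι × ℕ) →₀ ℤ) :
    topCoeff G c (D + 1) (expShift h) = topCoeff G c D h := by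
  funext i
  rw [topCoeff_apply, topCoeff_apply]
  by_cases hi : i ∈ G
  · by_cases hc : c i ≤ D
    · rw [if_pos ⟨hi, by omega⟩, if_pos ⟨hi, hc⟩, show D + 1 - c i = (D - c i) + 1 by omega,
        expShift_succ]
    · rw [if_neg (c := i ∈ G ∧ c i ≤ D) (by tauto)]
      split_ifs with h2
      · rw [show D + 1 - c i = 0 by omega, expShift_zero]
      · rfl
  · simp [hi]

theorem expShift_mem_degLT {T G : Finset ι} {c : ι → ℕ} {D : ℕ} {h : (ι × ℕ) →₀ ℤ}
    (hh : h ∈ degLT T G c D) : expShift h ∈ degLT T G c (D + 1) := by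
  rintro ⟨i, d⟩ hv
  rcases d with _ | d
  · simp at hv
  · rw [expShift_succ] at hv
    obtain ⟨h1, h2⟩ := hh _ hv
    refine ⟨h1, fun hi => ?_⟩
    have := h2 hi
    simp only at this ⊢
    omega

theorem mem_degLT_of_topCoeff_eq_zero {T G : Finset ι} {c : ι → ℕ} {D : ℕ}
    {h : (ι × ℕ) →₀ ℤ} (hh : h ∈ degLT T G c (D + 1)) (h0 : topCoeff G c D h = 0) :
    h ∈ degLT T G c D := by
  rintro ⟨i, d⟩ hv
  obtain ⟨h1, h2⟩ := hh _ hv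
  refine ⟨h1, fun hi => ?_⟩
  have h3 := h2 hi
  simp only at h3 ⊢
  refine lt_of_le_of_ne (by omega) fun he => hv ?_
  rw [← topCoeff_of_add_eq hi he, h0]
  rfl

theorem exists_mem_degLT {T G : Finset ι} {c : ι → ℕ} {h : (ι × ℕ) →₀ ℤ}
    (hT : ∀ v, h v ≠ 0 → v.1 ∈ T) : ∃ D, h ∈ degLT T G c D := by
  refine ⟨h.support.sup (fun v => v.2 + c v.1) + 1, fun v hv => ⟨hT v hv, fun _ => ?_⟩⟩
  exact Nat.lt_succ_of_le
    (Finset.le_sup (f := fun v : ι × ℕ => v.2 + c v.1) (Finsupp.mem_support_iff.2 hv))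

/-- The module of weighted leading coefficient vectors in degree `D`. -/
noncomputable def leadModule (T G : Finset ι) (c : ι → ℕ) (D : ℕ)
    (N : Submodule ℤ ((ι × ℕ) →₀ ℤ)) : Submodule ℤ (ι → ℤ) :=
  (N ⊓ degLT T G c (D + 1)).map (topCoeff G c D)

theorem leadModule_mono {T G : Finset ι} {c : ι → ℕ} {D : ℕ} :
    Monotone (leadModule T G c D) :=
  fun _ _ h => Submodule.map_mono (inf_le_inf_right _ h)

theorem eventually_leadModule_eq [Finite ι] (T G : Finset ι) (c : ι → ℕ)
    {Γ : ℕ → Submodule ℤ ((ι × ℕ) →₀ ℤ)} (hΓ : Monotone Γ) (D : ℕ) :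
    ∀ᶠ k in atTop, leadModule T G c D (⨆ l, Γ l) ≤ leadModule T G c D (Γ k) := by
  obtain ⟨m, hm⟩ := monotone_stabilizes_iff_noetherian.mpr
    (inferInstance : IsNoetherian ℤ (ι → ℤ))
    ⟨fun k => leadModule T G c D (Γ k), leadModule_mono.comp hΓ⟩
  filter_upwards [eventually_ge_atTop m] with k hk
  rintro _ ⟨h, ⟨h1, h2⟩, rfl⟩
  obtain ⟨l, hl⟩ := (Submodule.mem_iSup_of_directed Γ hΓ.directed_le).1 h1
  have h3 : topCoeff G c D h ∈ leadModule T G c D (Γ (max l m)) :=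
    ⟨h, ⟨hΓ (le_max_left l m) hl, h2⟩, rfl⟩
  have h4 := hm (max l m) (le_max_right _ _)
  have h5 := hm k hk
  simp only [OrderHom.coe_mk] at h4 h5
  rwa [← h4, h5] at h3

theorem Ultrafilter.exists_eventually_of_eventually_exists_le (U : Ultrafilter ℕ)
    {p : ℕ → ℕ → Prop} (B : ℕ) (h : ∀ᶠ k in U, ∃ c ≤ B, p c k) : ∃ c, ∀ᶠ k in U, p c k := by
  obtain ⟨c, -, hc⟩ := (U.finite_biUnion_mem_iff (is := Set.Iic B) (s := fun c => {k | p c k})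
    (Set.finite_Iic B)).1 (by
      filter_upwards [h] with k hk
      simpa using hk)
  exact ⟨c, hc⟩

/-- Components whose degree bounds grow slowest along an ultrafilter, normalised to a common
bound `A`. -/
theorem exists_slowest_components [Finite ι] (U : Ultrafilter ℕ) (a : ℕ → ι → ℕ∞)
    {T : Finset ι} (hT : T.Nonempty) :
    ∃ G ⊆ T, G.Nonempty ∧ ∃ (c : ι → ℕ) (A : ℕ → ℕ∞),
      (∀ᶠ k in U, ∀ i ∈ G, a k i + c i = A k) ∧
      ∀ i ∈ T, i ∉ G → ∀ N : ℕ, ∀ᶠ k in U, A k + N < a k i := by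
  classical
  let r : ι → ι → Prop := fun i j => ∀ N : ℕ, ∀ᶠ k in U, a k i + N < a k j
  have : IsTrans ι r := ⟨fun i j l hij hjl N => by
    filter_upwards [hij N, hjl 0] with k h1 h2
    exact h1.trans (by simpa using h2)⟩
  have : Std.Irrefl r := ⟨fun i h => by
    obtain ⟨k, hk⟩ := (h 0).exists
    simp at hk⟩
  obtain ⟨i₀, hi₀, hmin⟩ := (Finite.wellFounded_of_trans_of_irrefl r).has_min (T : Set ι) hT
  have hnot : ∀ i j, ¬ r i j → ∃ N : ℕ, ∀ᶠ k in U, a k j ≤ a k i + N := by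
    intro i j h
    simp only [r, not_forall] at h
    obtain ⟨N, hN⟩ := h
    refine ⟨N, ?_⟩
    simpa using Ultrafilter.eventually_not.2 hN
  let G := T.filter fun i => ¬ r i₀ i
  have h1 : ∀ i : ι, ∃ N : ℕ, i ∈ G → ∀ᶠ k in U, a k i ≤ a k i₀ + N := by
    intro i
    by_cases hi : i ∈ G
    · obtain ⟨N, hN⟩ := hnot _ _ (Finset.mem_filter.1 hi).2
      exact ⟨N, fun _ => hN⟩
    · exact ⟨0, fun h => absurd h hi⟩
  choose N hN using h1
  let B := G.sup N
  have h2 : ∀ i : ι, ∃ c : ℕ, i ∈ G → ∀ᶠ k in U, a k i + c = a k i₀ + B := by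
    intro i
    by_cases hi : i ∈ G
    · obtain ⟨N', hN'⟩ := hnot _ _ (hmin i (Finset.mem_filter.1 hi).1)
      obtain ⟨c, hc⟩ := U.exists_eventually_of_eventually_exists_le
        (p := fun c k => a k i + c = a k i₀ + B) (N' + B) (by
          filter_upwards [hN i hi, hN'] with k hk1 hk2
          have hB : N i ≤ B := Finset.le_sup hi
          generalize a k i = x at hk1 hk2 ⊢
          generalize a k i₀ = y at hk1 hk2 ⊢
          induction x using ENat.recTopCoe with
          | top =>
            refine ⟨0, by omega, ?_⟩
            induction y using ENat.recTopCoe with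
            | top => simp
            | coe y =>
              rw [← Nat.cast_add] at hk1
              exact absurd hk1 (by simp)
          | coe x =>
            induction y using ENat.recTopCoe with
            | top =>
              rw [← Nat.cast_add] at hk2
              exact absurd hk2 (by simp)
            | coe y =>
              norm_cast at hk1 hk2 ⊢
              exact ⟨y + B - x, by omega, by omega⟩)
      exact ⟨c, fun _ => hc⟩
    · exact ⟨0, fun h => absurd h hi⟩
  choose c hc using h2
  refine ⟨G, Finset.filter_subset _ _, ⟨i₀, ?_⟩, c, fun k => a k i₀ + B, ?_, ?_⟩
  · exact Finset.mem_filter.2 ⟨hi₀, irrefl i₀⟩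
  · exact (G.eventually_all).2 fun i hi => hc i hi
  · intro i hi hiG M
    have hr : r i₀ i := by
      by_contra h
      exact hiG (Finset.mem_filter.2 ⟨hi, h⟩)
    filter_upwards [hr (B + M)] with k hk
    push_cast at hk
    rwa [add_assoc]

section Closure

variable {U : Ultrafilter ℕ} {a : ℕ → ι → ℕ∞}
  {Γ : ℕ → Submodule ℤ ((ι × ℕ) →₀ ℤ)}

theorem exists_stable_degree [Finite ι] (hU : (U : Filter ℕ) ≤ atTop) (hΓ : Monotone Γ)
    (hM : ∀ k, ∀ h ∈ Γ k, ∀ i (d : ℕ), a k i ≤ d → h (i, d) = 0)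
    (hx : ∀ k, ∀ h ∈ Γ k, (∀ i (d : ℕ), a k i ≤ d → expShift h (i, d) ≤ 0) → expShift h ∈ Γ k)
    {T G : Finset ι} {c : ι → ℕ} {A : ℕ → ℕ∞}
    (hA : ∀ᶠ k in U, ∀ i ∈ G, a k i + c i = A k)
    (hAT : ∀ i ∈ T, i ∉ G → ∀ N : ℕ, ∀ᶠ k in U, A k + N < a k i) :
    ∃ D₀ : ℕ, (∀ᶠ k in U, D₀ ≤ A k) ∧ ∀ D, ∀ h ∈ (⨆ l, Γ l) ⊓ degLT T G c (D + 1),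
      topCoeff G c D h ∈ leadModule T G c (min D D₀) (⨆ l, Γ l) := by
  by_cases hb : ∃ B : ℕ, ∀ᶠ k in U, A k ≤ B
  · obtain ⟨B, hB⟩ := hb
    obtain ⟨A₀, hA₀⟩ := U.exists_eventually_of_eventually_exists_le
      (p := fun c k => A k = c) B (by
        filter_upwards [hB] with k hk
        obtain ⟨m, hm, hmB⟩ := ENat.le_natCast_iff.1 hk
        exact ⟨m, hmB, hm⟩)
    refine ⟨A₀, hA₀.mono fun k hk => hk.ge, fun D h hh => ?_⟩
    rcases le_or_gt A₀ D with hD | hD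
    · obtain ⟨l, hl⟩ := (Submodule.mem_iSup_of_directed Γ hΓ.directed_le).1 hh.1
      obtain ⟨k, hk1, hk2, hk3⟩ :=
        (hA₀.and (hA.and (hU (eventually_ge_atTop l)))).exists
      rw [topCoeff_eq_zero_of_forall]
      · exact Submodule.zero_mem _
      · intro i hi d hd
        refine hM k h (hΓ hk3 hl) i d ?_
        have h1 := hk2 i hi
        rw [hk1] at h1
        refine (ENat.add_le_add_iff_right (ENat.natCast_ne_top (c i))).1 ?_
        rw [h1]
        exact_mod_cast hd ▸ hD
    · rw [min_eq_left hD.le]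
      exact ⟨h, hh, rfl⟩
  · have hunb : ∀ B : ℕ, ∀ᶠ k in U, B < A k := by
      intro B
      simpa using Ultrafilter.eventually_not.2 (not_exists.1 hb B)
    have hTunb : ∀ i ∈ T, ∀ N : ℕ, ∀ᶠ k in U, N < a k i := by
      intro i hi N
      by_cases hiG : i ∈ G
      · filter_upwards [hA, hunb (N + c i)] with k hk1 hk2
        rw [← hk1 i hiG] at hk2
        push_cast at hk2
        exact (ENat.add_lt_add_iff_right (ENat.natCast_ne_top (c i))).1 hk2
      · filter_upwards [hAT i hi hiG N] with k hk
        exact le_add_self.trans_lt hk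
    have hclosed : ∀ D, ∀ h ∈ (⨆ l, Γ l) ⊓ degLT T G c D, expShift h ∈ ⨆ l, Γ l := by
      rintro D h ⟨h1, h2⟩
      obtain ⟨l, hl⟩ := (Submodule.mem_iSup_of_directed Γ hΓ.directed_le).1 h1
      obtain ⟨E, hE⟩ := exists_mem_degLT (G := T) (c := 0) fun v hv => (h2 v hv).1
      obtain ⟨k, hk1, hk2⟩ := (((T.eventually_all).2 fun i hi => hTunb i hi E).and
        (hU (eventually_ge_atTop l))).exists
      refine Submodule.mem_iSup_of_mem k (hx k h (hΓ hk2 hl) fun i d hd => ?_)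
      by_contra hne
      have hv : expShift h (i, d) ≠ 0 := by
        intro h0
        exact hne h0.le
      obtain ⟨h3, h4⟩ := expShift_mem_degLT hE _ hv
      have h5 := h4 h3
      have h6 := (hk1 i h3).trans_le hd
      simp only [Pi.zero_apply, add_zero] at h5
      have h7 : E < d := by exact_mod_cast h6
      omega
    have hmono : Monotone fun D => leadModule T G c D (⨆ l, Γ l) := by
      refine monotone_nat_of_le_succ fun D => ?_
      rintro _ ⟨h, hh, rfl⟩
      exact ⟨expShift h, ⟨hclosed _ h hh, expShift_mem_degLT hh.2⟩, topCoeff_expShift _ _ _ _⟩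
    obtain ⟨D₀, hD₀⟩ := monotone_stabilizes_iff_noetherian.mpr
      (inferInstance : IsNoetherian ℤ (ι → ℤ)) ⟨_, hmono⟩
    refine ⟨D₀, (hunb D₀).mono fun k hk => hk.le, fun D h hh => ?_⟩
    have h1 : topCoeff G c D h ∈ leadModule T G c D (⨆ l, Γ l) := ⟨h, hh, rfl⟩
    rcases le_total D D₀ with hD | hD
    · rwa [min_eq_left hD]
    · rw [min_eq_right hD]
      have := hD₀ D hD
      simp only [OrderHom.coe_mk] at this
      rwa [this]

theorem iterate_expShift_mem {k k₀ : ℕ} {T G : Finset ι} {c : ι → ℕ} {A : ℕ∞} {D D' : ℕ}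
    {g h : (ι × ℕ) →₀ ℤ} (hΓ : Monotone Γ)
    (hM : ∀ k, ∀ h ∈ Γ k, ∀ i (d : ℕ), a k i ≤ d → h (i, d) = 0)
    (hx : ∀ k, ∀ h ∈ Γ k, (∀ i (d : ℕ), a k i ≤ d → expShift h (i, d) ≤ 0) → expShift h ∈ Γ k)
    (hA : ∀ i ∈ G, a k i + c i = A) (hk : k₀ ≤ k)
    (hAT : ∀ i ∈ T, i ∉ G → A + a k₀ i ≤ a k i)
    (hg : g ∈ Γ k₀ ⊓ degLT T G c (D' + 1)) (hgh : topCoeff G c D' g = topCoeff G c D h)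
    (hneg : ∀ i (d : ℕ), a k i ≤ d → h (i, d) ≤ 0) (s : ℕ) (hs : D' + s ≤ D)
    (hsA : ((D' + s : ℕ) : ℕ∞) ≤ A) :
    expShift^[s] g ∈ Γ k ⊓ degLT T G c (D' + s + 1) ∧
      topCoeff G c (D' + s) (expShift^[s] g) = topCoeff G c D h ∧
      ∀ i (d : ℕ), a k₀ i + s ≤ d → (expShift^[s] g) (i, d) = 0 := by
  induction s with
  | zero =>
    refine ⟨⟨hΓ hk hg.1, hg.2⟩, hgh, fun i d hd => hM k₀ g hg.1 i d ?_⟩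
    simpa using hd
  | succ s ih =>
    obtain ⟨⟨h1, h2⟩, h3, h4⟩ := ih (by omega) (le_trans (by exact_mod_cast by omega) hsA)
    rw [Function.iterate_succ_apply']
    set f := expShift^[s] g
    have hdeg : expShift f ∈ degLT T G c (D' + (s + 1) + 1) := expShift_mem_degLT h2
    have htop : topCoeff G c (D' + (s + 1)) (expShift f) = topCoeff G c D h := by
      rw [← h3]
      exact topCoeff_expShift G c (D' + s) f
    have hvan : ∀ i (d : ℕ), a k₀ i + (s + 1 : ℕ) ≤ d → expShift f (i, d) = 0 := by
      intro i d hd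
      rcases d with _ | d
      · simp
      · rw [expShift_succ]
        refine h4 i d ?_
        push_cast at hd
        rw [← add_assoc] at hd
        exact (ENat.add_le_add_iff_right ENat.one_ne_top).1 hd
    refine ⟨⟨hx k f h1 fun i d hd => ?_, hdeg⟩, htop, hvan⟩
    by_contra hne
    have hv : expShift f (i, d) ≠ 0 := fun h0 => hne h0.le
    obtain ⟨hiT, hiG⟩ := hdeg _ hv
    by_cases hi : i ∈ G
    · have h5 := hiG hi
      simp only at h5
      have h6 : A ≤ ((d + c i : ℕ) : ℕ∞) := by
        rw [← hA i hi]
        push_cast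
        gcongr
      have h7 : D' + (s + 1) ≤ d + c i := by exact_mod_cast hsA.trans h6
      have h8 : d + c i = D' + (s + 1) := by omega
      have h9 := congrFun htop i
      rw [topCoeff_of_add_eq hi h8, topCoeff_apply, if_pos ⟨hi, by omega⟩] at h9
      apply hne
      rw [h9]
      refine hneg i _ (hd.trans ?_)
      exact_mod_cast by omega
    · refine hv (hvan i d ?_)
      refine le_trans ?_ (hd.trans' (hAT i hiT hi))
      rw [add_comm]
      gcongr
      exact le_trans (by exact_mod_cast by omega) hsA

theorem eventually_mem_of_nonpos [Finite ι] (hU : (U : Filter ℕ) ≤ atTop) (ha : Monotone a)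
    (hΓ : Monotone Γ) (hM : ∀ k, ∀ h ∈ Γ k, ∀ i (d : ℕ), a k i ≤ d → h (i, d) = 0)
    (hx : ∀ k, ∀ h ∈ Γ k, (∀ i (d : ℕ), a k i ≤ d → expShift h (i, d) ≤ 0) → expShift h ∈ Γ k)
    (T : Finset ι) :
    ∀ᶠ k in U, ∀ h ∈ ⨆ l, Γ l, (∀ v, h v ≠ 0 → v.1 ∈ T) →
      (∀ i (d : ℕ), a k i ≤ d → h (i, d) ≤ 0) → h ∈ Γ k := by
  classical
  induction T using Finset.strongInduction with
  | H T ih =>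
    rcases T.eq_empty_or_nonempty with rfl | hT
    · refine .of_forall fun k h _ hT _ => ?_
      have : h = 0 := by
        ext v
        by_contra hv
        simpa using hT v hv
      rw [this]
      exact Submodule.zero_mem _
    obtain ⟨G, hGT, hG, c, A, hA, hAT⟩ := exists_slowest_components U a hT
    obtain ⟨D₀, hD₀, hlead⟩ := exists_stable_degree hU hΓ hM hx hA hAT
    obtain ⟨k₀, hk₀⟩ := ((Finset.range (D₀ + 1)).eventually_all.2 fun D _ =>
      eventually_leadModule_eq T G c hΓ D).exists
    have hAT' : ∀ᶠ k in U, ∀ i ∈ T, i ∉ G → A k + a k₀ i ≤ a k i := by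
      refine T.eventually_all.2 fun i hi => ?_
      by_cases hiG : i ∈ G
      · exact .of_forall fun k h => absurd hiG h
      · by_cases h : a k₀ i = ⊤
        · filter_upwards [hU (eventually_ge_atTop k₀)] with k hk _
          have h1 := ha hk i
          rw [h, top_le_iff] at h1
          rw [h1]
          exact le_top
        · obtain ⟨N, hN⟩ := ENat.ne_top_iff_exists.1 h
          filter_upwards [hAT i hi hiG N] with k hk _
          rw [← hN]
          exact hk.le
    filter_upwards [ih (T \ G) (Finset.sdiff_ssubset hGT hG), hA, hD₀, hAT',
      hU (eventually_ge_atTop k₀)] with k hk_ih hk_A hk_D hk_AT hk h hhΓ hhT hneg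
    obtain ⟨D, hD⟩ := exists_mem_degLT (G := G) (c := c) hhT
    clear hhT
    induction D generalizing h with
    | zero =>
      refine hk_ih h hhΓ (fun v hv => ?_) hneg
      obtain ⟨h1, h2⟩ := hD v hv
      exact Finset.mem_sdiff.2 ⟨h1, fun h3 => absurd (h2 h3) (by omega)⟩
    | succ D ihD =>
      suffices hg : ∃ g ∈ Γ k ⊓ degLT T G c (D + 1), topCoeff G c D g = topCoeff G c D h by
        obtain ⟨g, ⟨hg1, hg2⟩, hg3⟩ := hg
        have h1 : h - g ∈ Γ k := by
          refine ihD (h - g) (Submodule.sub_mem _ hhΓ (Submodule.mem_iSup_of_mem k hg1))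
            (fun i d hd => ?_) (mem_degLT_of_topCoeff_eq_zero (Submodule.sub_mem _ hD hg2) ?_)
          · rw [Finsupp.sub_apply, hM k g hg1 i d hd, sub_zero]
            exact hneg i d hd
          · rw [map_sub, hg3, sub_self]
        simpa using Submodule.add_mem _ h1 hg1
      obtain ⟨g, hg, hgh⟩ := hk₀ (min D D₀) (Finset.mem_range.2 (by omega))
        (hlead D h ⟨hhΓ, hD⟩)
      have key := iterate_expShift_mem hΓ hM hx hk_A hk hk_AT hg hgh hneg
      rcases le_or_gt (D : ℕ∞) (A k) with hDA | hDA
      · obtain ⟨h1, h2, -⟩ := key (D - min D D₀) (by omega)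
          (by rwa [show min D D₀ + (D - min D D₀) = D by omega])
        rw [show min D D₀ + (D - min D D₀) = D by omega] at h1 h2
        exact ⟨_, h1, h2⟩
      · obtain ⟨m, hm⟩ := ENat.ne_top_iff_exists.1 hDA.ne_top
        rw [← hm] at hDA hk_D
        have hDA' : m < D := by exact_mod_cast hDA
        have hk_D' : D₀ ≤ m := by exact_mod_cast hk_D
        obtain ⟨h1, h2, -⟩ := key (m - D₀) (by omega) (by
          rw [← hm]
          exact_mod_cast by omega)
        refine ⟨0, Submodule.zero_mem _, ?_⟩
        rw [map_zero, ← h2, eq_comm]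
        refine topCoeff_eq_zero_of_forall fun i hi d hd => hM k _ h1.1 i d ?_
        refine (ENat.add_le_add_iff_right (ENat.natCast_ne_top (c i))).1 ?_
        rw [hk_A i hi, ← hm]
        exact_mod_cast by omega

end Closure

end TruncatedLattices

namespace MvPolynomial

section BinomialRelations

variable {V K : Type*} [Field K]

theorem monomial_mem_iff {P : Ideal (MvPolynomial V K)} (hP : P.IsPrime) (u : V →₀ ℕ) :
    monomial u (1 : K) ∈ P ↔ ∃ v, u v ≠ 0 ∧ (X v : MvPolynomial V K) ∈ P := by
  rw [monomial_eq, C_1, one_mul, Finsupp.prod, hP.prod_mem_iff]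
  constructor
  · rintro ⟨v, hv, h⟩
    exact ⟨v, Finsupp.mem_support_iff.1 hv, hP.mem_of_pow_mem _ h⟩
  · rintro ⟨v, hv, h⟩
    exact ⟨v, Finsupp.mem_support_iff.2 hv, Ideal.pow_mem_of_mem _ h _ (Nat.pos_of_ne_zero hv)⟩

theorem monomial_add_one (u v : V →₀ ℕ) :
    monomial (u + v) (1 : K) = monomial u 1 * monomial v 1 := by
  rw [monomial_mul, one_mul]

/-- The positive part of an exponent vector. -/
noncomputable def expPos (h : V →₀ ℤ) : V →₀ ℕ := h.mapRange Int.toNat rfl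

@[simp]
theorem expPos_apply (h : V →₀ ℤ) (v : V) : expPos h v = (h v).toNat := rfl

/-- Modulo `P`, the monomials in the positive and negative part of `h` are nonzero with
quotient `c`. -/
def LaurentRel (P : Ideal (MvPolynomial V K)) (h : V →₀ ℤ) (c : K) : Prop :=
  monomial (expPos h) (1 : K) ∉ P ∧ monomial (expPos (-h)) (1 : K) ∉ P ∧
    monomial (expPos h) (1 : K) - C c * monomial (expPos (-h)) 1 ∈ P

theorem exists_add_expPos {u v : V →₀ ℕ} {h : V →₀ ℤ} (huv : ∀ x, (u x : ℤ) - v x = h x) :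
    ∃ m, u = expPos h + m ∧ v = expPos (-h) + m := by
  refine ⟨u - expPos h, ?_, ?_⟩ <;> ext x <;> have := huv x <;>
    simp only [Finsupp.add_apply, Finsupp.tsub_apply, expPos_apply, Finsupp.neg_apply] <;> omega

theorem binomial_factor (c : K) (p q m : V →₀ ℕ) :
    monomial (p + m) (1 : K) - C c * monomial (q + m) 1 =
      (monomial p 1 - C c * monomial q 1) * monomial m 1 := by
  rw [monomial_add_one, monomial_add_one]
  ring

theorem LaurentRel.mem {P : Ideal (MvPolynomial V K)} {h : V →₀ ℤ} {c : K}
    (H : LaurentRel P h c) {u v : V →₀ ℕ} (huv : ∀ x, (u x : ℤ) - v x = h x) :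
    monomial u (1 : K) - C c * monomial v 1 ∈ P := by
  obtain ⟨m, rfl, rfl⟩ := exists_add_expPos huv
  rw [binomial_factor]
  exact P.mul_mem_right _ H.2.2

theorem LaurentRel.of_mem {P : Ideal (MvPolynomial V K)} (hP : P.IsPrime) {h : V →₀ ℤ} {c : K}
    {u v : V →₀ ℕ} (huv : ∀ x, (u x : ℤ) - v x = h x) (hu : monomial u (1 : K) ∉ P)
    (hv : monomial v (1 : K) ∉ P) (H : monomial u (1 : K) - C c * monomial v 1 ∈ P) :
    LaurentRel P h c := by
  obtain ⟨m, rfl, rfl⟩ := exists_add_expPos huv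
  rw [binomial_factor] at H
  rw [monomial_add_one] at hu hv
  exact ⟨fun h => hu (P.mul_mem_right _ h), fun h => hv (P.mul_mem_right _ h),
    (hP.mem_or_mem H).resolve_right fun h => hu (P.mul_mem_left _ h)⟩

theorem LaurentRel.zero {P : Ideal (MvPolynomial V K)} (hP : P.IsPrime) :
    LaurentRel P 0 1 := by
  have h1 : monomial (0 : V →₀ ℕ) (1 : K) ∉ P := by
    rw [← C_apply, C_1]
    exact hP.one_notMem
  refine .of_mem hP (u := 0) (v := 0) (by simp) h1 h1 ?_
  simp

theorem LaurentRel.neg {P : Ideal (MvPolynomial V K)} (hP : P.IsPrime) {h : V →₀ ℤ} {c : K}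
    (hc : c ≠ 0) (H : LaurentRel P h c) : LaurentRel P (-h) c⁻¹ := by
  refine .of_mem hP (u := expPos (-h)) (v := expPos h) (fun x => ?_) H.2.1 H.1 ?_
  · simp only [expPos_apply, Finsupp.neg_apply]
    omega
  · have h1 : monomial (expPos (-h)) (1 : K) - C c⁻¹ * monomial (expPos h) 1 =
        -(C c⁻¹ * (monomial (expPos h) (1 : K) - C c * monomial (expPos (-h)) 1)) := by
      rw [mul_sub, ← mul_assoc, ← C_mul, inv_mul_cancel₀ hc, C_1]
      ring
    rw [h1]
    exact P.neg_mem (P.mul_mem_left _ H.2.2)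

theorem LaurentRel.add {P : Ideal (MvPolynomial V K)} (hP : P.IsPrime) {g h : V →₀ ℤ} {b c : K}
    (G : LaurentRel P g b) (H : LaurentRel P h c) : LaurentRel P (g + h) (b * c) := by
  refine .of_mem hP (u := expPos g + expPos h) (v := expPos (-g) + expPos (-h)) (fun x => ?_)
    ?_ ?_ ?_
  · simp only [expPos_apply, Finsupp.neg_apply, Finsupp.add_apply]
    push_cast
    omega
  · rw [monomial_add_one]
    exact hP.mul_notMem G.1 H.1
  · rw [monomial_add_one]
    exact hP.mul_notMem G.2.1 H.2.1
  · have h1 : monomial (expPos g + expPos h) (1 : K) -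
        C (b * c) * monomial (expPos (-g) + expPos (-h)) 1 =
        monomial (expPos g) (1 : K) *
          (monomial (expPos h) (1 : K) - C c * monomial (expPos (-h)) 1) +
        C c * monomial (expPos (-h)) 1 *
          (monomial (expPos g) (1 : K) - C b * monomial (expPos (-g)) 1) := by
      rw [monomial_add_one, monomial_add_one, C_mul]
      ring
    rw [h1]
    exact P.add_mem (P.mul_mem_left _ H.2.2) (P.mul_mem_left _ G.2.2)

theorem LaurentRel.unique {P : Ideal (MvPolynomial V K)} (hP : P.IsPrime) {h : V →₀ ℤ}
    {b c : K} (G : LaurentRel P h b) (H : LaurentRel P h c) : b = c := by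
  by_contra hne
  have h1 := P.sub_mem H.2.2 G.2.2
  rw [sub_sub_sub_cancel_left, ← sub_mul, ← C_sub] at h1
  have h2 := (hP.mem_or_mem h1).resolve_right G.2.1
  exact hP.ne_top (P.eq_top_of_isUnit_mem h2
    (((isUnit_iff_ne_zero.2 (sub_ne_zero.2 hne)).map (C : K →+* MvPolynomial V K))))

/-- The exponents of the Laurent relations common to all `P l` with `k ≤ l`. -/
noncomputable def relationModule (P : ℕ → Ideal (MvPolynomial V K)) (hP : ∀ k, (P k).IsPrime)
    (k : ℕ) : Submodule ℤ (V →₀ ℤ) :=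
  AddSubgroup.toIntSubmodule
    { carrier := {h | ∃ c : K, c ≠ 0 ∧ ∀ l, k ≤ l → LaurentRel (P l) h c}
      zero_mem' := ⟨1, one_ne_zero, fun l _ => .zero (hP l)⟩
      add_mem' := by
        rintro g h ⟨b, hb, G⟩ ⟨c, hc, H⟩
        exact ⟨b * c, mul_ne_zero hb hc, fun l hl => (G l hl).add (hP l) (H l hl)⟩
      neg_mem' := by
        rintro h ⟨c, hc, H⟩
        exact ⟨c⁻¹, inv_ne_zero hc, fun l hl => (H l hl).neg (hP l) hc⟩ }

theorem mem_relationModule {P : ℕ → Ideal (MvPolynomial V K)} {hP : ∀ k, (P k).IsPrime}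
    {k : ℕ} {h : V →₀ ℤ} :
    h ∈ relationModule P hP k ↔ ∃ c : K, c ≠ 0 ∧ ∀ l, k ≤ l → LaurentRel (P l) h c :=
  Iff.rfl

end BinomialRelations

end MvPolynomial

section SigmaPrimes

variable {R : Type*} [CommRing R] {σ : R →+* R}

theorem isSigmaIdeal_of_mem_minimalPrimes {J P : Ideal R} (hJ : IsWellMixed σ J)
    (hJr : J.IsRadical) (hP : P ∈ J.minimalPrimes) : IsSigmaIdeal σ P := by
  intro x hx
  have hprime : P.IsPrime := hP.1.1
  have hJP : J ≤ P := hP.1.2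
  obtain ⟨y, hy, n, hyx⟩ : ∃ y ∉ P, ∃ n : ℕ, y * x ^ n ∈ J := by
    by_contra! hcon
    have hdisj : Disjoint (J : Set R) (P.primeCompl ⊔ Submonoid.powers x : Submonoid R) := by
      rw [Set.disjoint_left]
      intro z hz hz'
      obtain ⟨y, hy, w, ⟨n, rfl⟩, rfl⟩ := Submonoid.mem_sup.1 hz'
      exact hcon y hy n hz
    obtain ⟨Q, hQ, hJQ, hQd⟩ := Ideal.exists_le_prime_disjoint J _ hdisj
    have hQP : Q ≤ P := fun z hz => by
      by_contra hzP
      exact Set.disjoint_left.1 hQd hz (Submonoid.mem_sup_left hzP)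
    exact Set.disjoint_left.1 hQd (hP.2 ⟨hQ, hJQ⟩ hQP hx)
      (Submonoid.mem_sup_right (Submonoid.mem_powers x))
  have h1 : y * x ∈ J := by
    refine hJr ⟨n + 1, ?_⟩
    rw [mul_pow, show y ^ (n + 1) * x ^ (n + 1) = y * x ^ n * (y ^ n * x) by ring]
    exact J.mul_mem_right _ hyx
  exact (hprime.mem_or_mem (hJP (hJ y x h1))).resolve_left hy

theorem subset_rwmClosure (F : Set R) : F ⊆ rwmClosure σ F := fun _ hx =>
  Ideal.mem_sInf.2 fun _ hI => hI.1 hx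

theorem rwmClosure_le {F : Set R} {I : Ideal R} (hF : F ⊆ I) (h1 : IsSigmaIdeal σ I)
    (h2 : IsWellMixed σ I) (h3 : I.IsRadical) : rwmClosure σ F ≤ I :=
  sInf_le ⟨hF, h1, h2, h3⟩

theorem isSigmaIdeal_rwmClosure (F : Set R) : IsSigmaIdeal σ (rwmClosure σ F) := fun a ha =>
  Ideal.mem_sInf.2 fun _ hI => hI.2.1 a (Ideal.mem_sInf.1 ha hI)

theorem isWellMixed_rwmClosure (F : Set R) : IsWellMixed σ (rwmClosure σ F) := fun a b ha =>
  Ideal.mem_sInf.2 fun _ hI => hI.2.2.1 a b (Ideal.mem_sInf.1 ha hI)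

theorem isRadical_rwmClosure (F : Set R) : (rwmClosure σ F).IsRadical := by
  rintro x ⟨m, hm⟩
  exact Ideal.mem_sInf.2 fun _ hI => hI.2.2.2 ⟨m, Ideal.mem_sInf.1 hm hI⟩

theorem rwmClosure_le_rwmClosure {F G : Set R} (h : F ⊆ rwmClosure σ G) :
    rwmClosure σ F ≤ rwmClosure σ G :=
  rwmClosure_le h (isSigmaIdeal_rwmClosure G) (isWellMixed_rwmClosure G) (isRadical_rwmClosure G)

theorem rwmClosure_sigmaIdealGen (S : Set R) :
    rwmClosure σ (sigmaIdealGen σ S : Set R) = rwmClosure σ S := by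
  refine le_antisymm (rwmClosure_le_rwmClosure ?_) (rwmClosure_le_rwmClosure ?_)
  · exact SetLike.coe_subset_coe.2 (sInf_le ⟨subset_rwmClosure S, isSigmaIdeal_rwmClosure S⟩)
  · exact Set.Subset.trans (fun _ hx => Ideal.mem_sInf.2 fun _ hI => hI.1 hx) (subset_rwmClosure _)

theorem exists_sigma_stable_prime {F : Set R} {b : R} (hb : b ∉ rwmClosure σ F) :
    ∃ P : Ideal R, P.IsPrime ∧ IsSigmaIdeal σ P ∧ rwmClosure σ F ≤ P ∧ b ∉ P := by
  rw [← (isRadical_rwmClosure (σ := σ) F).radical, ← Ideal.sInf_minimalPrimes,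
    Ideal.mem_sInf] at hb
  push Not at hb
  obtain ⟨P, hP, hbP⟩ := hb
  exact ⟨P, hP.1.1, isSigmaIdeal_of_mem_minimalPrimes (isWellMixed_rwmClosure F)
    (isRadical_rwmClosure F) hP, hP.1.2, hbP⟩

end SigmaPrimes

namespace MvPolynomial

section Binomials

open Filter

variable {K : Type*} [Field K] {n : ℕ} {σK : K →+* K}

theorem shift_X (i : Fin n) (d : ℕ) :
    shift σK (X (i, d)) = (X (i, d + 1) : DPoly K n) := by
  simp [shift]

theorem shift_C (c : K) : shift σK (C c : DPoly K n) = C (σK c) := by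
  simp [shift]

theorem shift_iterate_X (i : Fin n) (k : ℕ) :
    (shift σK)^[k] (X (i, 0)) = (X (i, k) : DPoly K n) := by
  induction k with
  | zero => rfl
  | succ k ih => rw [Function.iterate_succ_apply', ih, shift_X]

theorem exists_monom_eq (f : Fin n → Polynomial ℕ) :
    ∃ u : (Fin n × ℕ) →₀ ℕ, monom σK f = monomial u (1 : K) := by
  suffices monom σK f ∈ MonoidHom.mrange (monomialOneHom K (Fin n × ℕ)) by
    obtain ⟨u, hu⟩ := this
    exact ⟨u.toAdd, hu.symm⟩
  refine Submonoid.prod_mem _ fun i _ => ?_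
  rw [ypow, sexp]
  refine Submonoid.prod_mem _ fun k _ => Submonoid.pow_mem _ ?_ _
  rw [shift_iterate_X]
  exact ⟨.ofAdd (Finsupp.single (i, k) 1), rfl⟩

theorem shift_monomial (u : (Fin n × ℕ) →₀ ℕ) :
    shift σK (monomial u (1 : K)) =
      monomial (u.mapDomain fun v => (v.1, v.2 + 1)) (1 : K) := by
  induction u using Finsupp.induction_linear with
  | zero => simp [shift]
  | add u v hu hv => rw [monomial_add_one, map_mul, hu, hv, Finsupp.mapDomain_add,
      monomial_add_one]
  | single v k =>
    rw [Finsupp.mapDomain_single, ← X_pow_eq_monomial, ← X_pow_eq_monomial, map_pow, ← shift_X]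

theorem LaurentRel.expShift_of_nonpos {P : Ideal (DPoly K n)} (hP : P.IsPrime)
    (hσ : IsSigmaIdeal (shift σK) P) {h : (Fin n × ℕ) →₀ ℤ} {c : K} (H : LaurentRel P h c)
    (hneg : ∀ v, X v ∈ P → expShift h v ≤ 0) : LaurentRel P (expShift h) (σK c) := by
  have h1 := hσ _ H.2.2
  rw [map_sub, map_mul, shift_C, shift_monomial, shift_monomial] at h1
  have hmap : ∀ (u : (Fin n × ℕ) →₀ ℕ) i d,
      u.mapDomain (fun v => (v.1, v.2 + 1)) (i, d + 1) = u (i, d) := fun u i d =>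
    Finsupp.mapDomain_apply expShift_injective_index u (i, d)
  have hmap0 : ∀ (u : (Fin n × ℕ) →₀ ℕ) i,
      u.mapDomain (fun v => (v.1, v.2 + 1)) (i, 0) = 0 := fun u i =>
    Finsupp.mapDomain_of_notMem_range _ _ (by rintro ⟨v, hv⟩; simp at hv)
  have h2 : monomial ((expPos h).mapDomain fun v => (v.1, v.2 + 1)) (1 : K) ∉ P := by
    rw [monomial_mem_iff hP]
    rintro ⟨⟨i, d⟩, hu, hX⟩
    rcases d with _ | d
    · exact hu (hmap0 _ _)
    · have h3 := hneg _ hX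
      rw [expShift_succ] at h3
      rw [hmap, expPos_apply] at hu
      omega
  refine .of_mem hP (fun x => ?_) h2 (fun h3 => h2 ?_) h1
  · obtain ⟨i, d⟩ := x
    rcases d with _ | d
    · rw [hmap0, hmap0]
      simp
    · rw [hmap, hmap, expShift_succ]
      simp only [expPos_apply, Finsupp.neg_apply]
      omega
  · have h4 := P.add_mem h1 (P.mul_mem_left (C (σK c)) h3)
    rwa [sub_add_cancel] at h4

theorem exists_vanishing_order {P : Ideal (DPoly K n)} (hσ : IsSigmaIdeal (shift σK) P) :
    ∃ a : Fin n → ℕ∞, ∀ i (d : ℕ), X (i, d) ∈ P ↔ a i ≤ d := by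
  classical
  suffices H : ∀ i : Fin n, ∃ a : ℕ∞, ∀ d : ℕ, X (i, d) ∈ P ↔ a ≤ d by
    choose a ha using H
    exact ⟨a, ha⟩
  intro i
  by_cases h : ∃ d, (X (i, d) : DPoly K n) ∈ P
  · refine ⟨Nat.find h, fun d => ⟨fun hd => by exact_mod_cast Nat.find_min' h hd, fun hd => ?_⟩⟩
    have hd' : Nat.find h ≤ d := by exact_mod_cast hd
    induction d, hd' using Nat.le_induction with
    | base => exact Nat.find_spec h
    | succ d hd' ih =>
      rw [← shift_X (σK := σK)]
      exact hσ _ (ih (by exact_mod_cast hd'))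
  · refine ⟨⊤, fun d => ⟨fun hd => absurd ⟨d, hd⟩ h, fun hd => ?_⟩⟩
    simp at hd

theorem exists_monomial_notMem_of_isBinomial {b : DPoly K n} (hb : IsBinomial σK b)
    {P : Ideal (DPoly K n)} (hbP : b ∉ P) :
    ∃ (α β : K) (u v : (Fin n × ℕ) →₀ ℕ), α ≠ 0 ∧ β ≠ 0 ∧
      b = C α * monomial u (1 : K) + C β * monomial v (1 : K) ∧ monomial u (1 : K) ∉ P := by
  obtain ⟨α, β, f, g, hα, hβ, rfl⟩ := hb
  obtain ⟨u, hu⟩ := exists_monom_eq (σK := σK) f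
  obtain ⟨v, hv⟩ := exists_monom_eq (σK := σK) g
  rw [hu, hv] at hbP ⊢
  by_cases h : monomial u (1 : K) ∈ P
  · exact ⟨β, α, v, u, hβ, hα, add_comm _ _, fun h' =>
      hbP (P.add_mem (P.mul_mem_left _ h) (P.mul_mem_left _ h'))⟩
  · exact ⟨α, β, u, v, hα, hβ, rfl, h⟩

theorem binomial_mem_iff {P : Ideal (DPoly K n)} {α β : K} (hα : α ≠ 0)
    (u v : (Fin n × ℕ) →₀ ℕ) :
    C α * monomial u (1 : K) + C β * monomial v (1 : K) ∈ P ↔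
      monomial u (1 : K) - C (-β / α) * monomial v 1 ∈ P := by
  have h : C α * monomial u (1 : K) + C β * monomial v (1 : K) =
      C α * (monomial u (1 : K) - C (-β / α) * monomial v 1) := by
    rw [mul_sub, ← mul_assoc, ← C_mul, mul_div_cancel₀ _ hα, C_neg]
    ring
  rw [h]
  exact P.unit_mul_mem_iff_mem ((isUnit_iff_ne_zero.2 hα).map C)

theorem binomial_sequence_false_of_monotone {a : ℕ → Fin n → ℕ∞} (ha : Monotone a)
    {P : ℕ → Ideal (DPoly K n)} (hP : ∀ k, (P k).IsPrime)
    (hσ : ∀ k, IsSigmaIdeal (shift σK) (P k)) (haP : ∀ k i (d : ℕ), X (i, d) ∈ P k ↔ a k i ≤ d)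
    {c : ℕ → K} (hc : ∀ k, c k ≠ 0) {u v : ℕ → (Fin n × ℕ) →₀ ℕ}
    (hu : ∀ k, monomial (u k) (1 : K) ∉ P k)
    (hlt : ∀ j k, j < k → monomial (u j) (1 : K) - C (c j) * monomial (v j) 1 ∈ P k)
    (hnot : ∀ k, monomial (u k) (1 : K) - C (c k) * monomial (v k) 1 ∉ P k) : False := by
  let h : ℕ → (Fin n × ℕ) →₀ ℤ := fun k =>
    (u k).mapRange Nat.cast rfl - (v k).mapRange Nat.cast rfl
  have huv : ∀ k x, (u k x : ℤ) - v k x = h k x := fun k x => rfl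
  have hrel : ∀ j l, j < l → LaurentRel (P l) (h j) (c j) := by
    intro j l hjl
    have h1 : monomial (u j) (1 : K) ∉ P l := by
      intro hmem
      obtain ⟨⟨i, d⟩, hd, hX⟩ := (monomial_mem_iff (hP l) _).1 hmem
      exact hu j ((monomial_mem_iff (hP j) _).2
        ⟨(i, d), hd, (haP j i d).2 ((ha hjl.le i).trans ((haP l i d).1 hX))⟩)
    refine .of_mem (hP l) (huv j) h1 (fun h2 => h1 ?_) (hlt j l hjl)
    have h3 := (P l).add_mem (hlt j l hjl) ((P l).mul_mem_left (C (c j)) h2)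
    rwa [sub_add_cancel] at h3
  have hmono : Monotone (relationModule P hP) := by
    rintro k l hkl g ⟨b, hb, H⟩
    exact ⟨b, hb, fun m hm => H m (hkl.trans hm)⟩
  have hM : ∀ k, ∀ g ∈ relationModule P hP k, ∀ i (d : ℕ), a k i ≤ d → g (i, d) = 0 := by
    rintro k g ⟨b, hb, H⟩ i d hd
    have hX := (haP k i d).2 hd
    obtain ⟨h1, h2, -⟩ := H k le_rfl
    rw [monomial_mem_iff (hP k)] at h1 h2
    push Not at h1 h2
    by_contra hne
    have h3 : expPos g (i, d) = 0 := by
      by_contra h4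
      exact h1 _ h4 hX
    have h4 : expPos (-g) (i, d) = 0 := by
      by_contra h4
      exact h2 _ h4 hX
    simp only [expPos_apply, Finsupp.neg_apply] at h3 h4
    omega
  have hx : ∀ k, ∀ g ∈ relationModule P hP k,
      (∀ i (d : ℕ), a k i ≤ d → expShift g (i, d) ≤ 0) → expShift g ∈ relationModule P hP k := by
    rintro k g ⟨b, hb, H⟩ hneg
    refine ⟨σK b, (map_ne_zero σK).2 hb, fun l hl => (H l hl).expShift_of_nonpos (hP l) (hσ l) ?_⟩
    rintro ⟨i, d⟩ hX
    exact hneg i d ((ha hl i).trans ((haP l i d).1 hX))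
  obtain ⟨k, hk⟩ := (eventually_mem_of_nonpos (U := hyperfilter ℕ) Nat.hyperfilter_le_atTop ha
    hmono hM hx Finset.univ).exists
  have hmem : h k ∈ relationModule P hP k := by
    refine hk (h k) (Submodule.mem_iSup_of_mem (k + 1) ⟨c k, hc k, fun l hl => hrel k l hl⟩)
      (fun v _ => Finset.mem_univ _) fun i d hd => ?_
    have h0 : u k (i, d) = 0 := by
      by_contra hne
      exact hu k ((monomial_mem_iff (hP k) _).2 ⟨_, hne, (haP k i d).2 hd⟩)
    rw [← huv, h0]
    omega
  obtain ⟨b, -, H⟩ := hmem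
  have hbc : b = c k := (H (k + 1) k.le_succ).unique (hP _) (hrel k (k + 1) k.lt_succ_self)
  exact hnot k (hbc ▸ (H k le_rfl).mem (huv k))

theorem binomial_sequence_false {b : ℕ → DPoly K n} (hb : ∀ k, IsBinomial σK (b k))
    {P : ℕ → Ideal (DPoly K n)} (hP : ∀ k, (P k).IsPrime)
    (hσ : ∀ k, IsSigmaIdeal (shift σK) (P k)) (hlt : ∀ j k, j < k → b j ∈ P k)
    (hnot : ∀ k, b k ∉ P k) : False := by
  choose α β u v hα hβ hbuv hu using fun k => exists_monomial_notMem_of_isBinomial (hb k) (hnot k)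
  choose a ha using fun k => exists_vanishing_order (hσ k)
  obtain ⟨g, hg⟩ := (wellQuasiOrdered_le (α := Fin n → ℕ∞)).exists_monotone_subseq a
  refine binomial_sequence_false_of_monotone (a := a ∘ g) (P := P ∘ g) (u := u ∘ g) (v := v ∘ g)
    (c := fun k => -β (g k) / α (g k)) (σK := σK) (fun k l hkl => hg k l hkl) (fun k => hP _)
    (fun k => hσ _) (fun k => ha _) (fun k => div_ne_zero (neg_ne_zero.2 (hβ _)) (hα _))
    (fun k => hu _) (fun j k hjk => ?_) (fun k => ?_)
  · simp only [Function.comp_apply]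
    rw [← binomial_mem_iff (hα _), ← hbuv]
    exact hlt _ _ (g.strictMono hjk)
  · simp only [Function.comp_apply]
    rw [← binomial_mem_iff (hα _), ← hbuv]
    exact hnot _

theorem exists_finite_rwmClosure_eq {S : Set (DPoly K n)} (hS : ∀ p ∈ S, IsBinomial σK p) :
    ∃ F ⊆ S, F.Finite ∧ rwmClosure (shift σK) S = rwmClosure (shift σK) F := by
  classical
  by_contra! hcon
  have hstep : ∀ F : {F : Finset (DPoly K n) // (F : Set (DPoly K n)) ⊆ S},
      ∃ b ∈ S, b ∉ rwmClosure (shift σK) (F.1 : Set (DPoly K n)) := by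
    intro F
    by_contra! h
    exact hcon F.1 F.2 F.1.finite_toSet (le_antisymm (rwmClosure_le_rwmClosure h)
      (rwmClosure_le_rwmClosure (F.2.trans (subset_rwmClosure S))))
  choose b hbS hb using hstep
  let F : ℕ → {F : Finset (DPoly K n) // (F : Set (DPoly K n)) ⊆ S} := fun k =>
    Nat.rec ⟨∅, by simp⟩ (fun _ F => ⟨insert (b F) F.1, by
      rw [Finset.coe_insert]
      exact Set.insert_subset (hbS F) F.2⟩) k
  have hF : Monotone fun k => (F k).1 := monotone_nat_of_le_succ fun k => Finset.subset_insert _ _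
  choose P hP hσ hFP hbP using fun k => exists_sigma_stable_prime (hb (F k))
  refine binomial_sequence_false (fun k => hS _ (hbS (F k))) hP hσ (fun j k hjk => ?_) hbP
  exact hFP k (subset_rwmClosure _ (hF (Nat.succ_le_of_lt hjk) (Finset.mem_insert_self _ _)))

end Binomials

end MvPolynomial

/-- For a binomial σ-ideal `I`, `⟨I⟩_r` is finitely generated as a radical
well-mixed σ-ideal, and there is no infinite strictly ascending chain of radical well-mixed
σ-ideals generated by binomials. -/
theorem stmt13 {K : Type*} [Field K] [CharZero K] {n : ℕ} (σK : K →+* K)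
    (I : Ideal (DPoly K n))
    (hI : ∃ S : Set (DPoly K n), (∀ p ∈ S, IsBinomial σK p) ∧
      I = sigmaIdealGen (shift σK) S) :
    FinGenAsRWM (shift σK) (rwmClosure (shift σK) (I : Set (DPoly K n))) ∧
    ¬ ∃ c : ℕ → Ideal (DPoly K n),
      (∀ k : ℕ, ∃ S : Set (DPoly K n), (∀ p ∈ S, IsBinomial σK p) ∧
        c k = rwmClosure (shift σK) S) ∧
      ∀ k : ℕ, c k < c (k + 1) := by
  constructor
  · obtain ⟨S, hS, rfl⟩ := hI
    obtain ⟨F, hFS, hF, h⟩ := MvPolynomial.exists_finite_rwmClosure_eq hS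
    rw [rwmClosure_sigmaIdealGen]
    exact ⟨F, hF, hFS.trans (subset_rwmClosure S), h⟩
  · rintro ⟨c, hc, hlt⟩
    have hstep : ∀ k, ∃ b, IsBinomial σK b ∧ b ∈ c (k + 1) ∧ b ∉ c k := by
      intro k
      obtain ⟨S, hS, hcS⟩ := hc (k + 1)
      obtain ⟨T, -, hcT⟩ := hc k
      by_contra! h
      refine (hlt k).not_ge ?_
      rw [hcS, hcT]
      refine rwmClosure_le_rwmClosure fun p hp => ?_
      rw [SetLike.mem_coe, ← hcT]
      exact h p (hS p hp) (hcS ▸ subset_rwmClosure S hp)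
    choose b hb hbmem hbnot using hstep
    have hprime : ∀ k, ∃ P : Ideal (DPoly K n), P.IsPrime ∧ IsSigmaIdeal (shift σK) P ∧
        c k ≤ P ∧ b k ∉ P := by
      intro k
      obtain ⟨S, -, hcS⟩ := hc k
      have h := hbnot k
      rw [hcS] at h ⊢
      exact exists_sigma_stable_prime h
    choose P hP hσ hcP hbP using hprime
    exact MvPolynomial.binomial_sequence_false hb hP hσ (fun j k hjk =>
      hcP k ((strictMono_nat_of_lt_succ hlt).monotone hjk (hbmem j))) hbP
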